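/- Let 0 < μ < L, n ≥ 1, κ = L/μ, and 0 < ε < 1. For any deterministic IFO algorithm making K oracle calls and outputting x_K, if the algorithm guarantees ‖x*_f − x_K‖ ≤ ε‖x*_f‖ for every f ∈ F^{μ,L}_n(ℓ2), then K ≥ n and K ≥ (1/4)·√(n(κ−1))·log(1/ε). -/

import Mathlib

/-!
STATEMENT 1: Any deterministic IFO algorithm guaranteeing relative accuracy `ε < 1`
on all of `F^{μ,L}_n(ℓ2)` must make at least `n` calls and at least
`(1/4)·√(n(κ−1))·log(1/ε)` calls, where `κ = L/μ`.
-/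

noncomputable section

/-- `ℓ2`, the Hilbert space of square-summable real sequences. -/
abbrev H2 : Type := lp (fun _ : ℕ => ℝ) 2

/-- A deterministic IFO algorithm making `K` oracle calls for sums of `n` components:
the `k`-th query `(i_k, x_k)` is a function of the previous `k` oracle answers
`(g_{i_j}(x_j), ∇g_{i_j}(x_j))`, and the output is a function of all `K` answers. -/
structure IFOAlgorithm (n K : ℕ) where
  query : (k : ℕ) → (Fin k → ℝ × H2) → Fin n × H2
  output : (Fin K → ℝ × H2) → H2

namespace IFOAlgorithm

variable {n K : ℕ}

/-- The sequence of oracle answers produced when the algorithm is run against the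
components `g` with gradients `gg`. -/
def answers (A : IFOAlgorithm n K) (g : Fin n → H2 → ℝ) (gg : Fin n → H2 → H2) :
    (k : ℕ) → Fin k → ℝ × H2
  | 0 => Fin.elim0
  | (k + 1) =>
    Fin.snoc (A.answers g gg k)
      ((g (A.query k (A.answers g gg k)).1 (A.query k (A.answers g gg k)).2,
        gg (A.query k (A.answers g gg k)).1 (A.query k (A.answers g gg k)).2))

/-- The point `x_K` output by the algorithm after `K` oracle calls. -/
def run (A : IFOAlgorithm n K) (g : Fin n → H2 → ℝ) (gg : Fin n → H2 → H2) : H2 :=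
  A.output (A.answers g gg K)

end IFOAlgorithm

open scoped InnerProductSpace

/-- The function `x ↦ (ℓ/8)‖D x - b‖²`. -/
def quad (l : ℝ) (D : H2 →L[ℝ] H2) (b x : H2) : ℝ := l / 8 * ‖D x - b‖ ^ 2

/-- The gradient of `quad l D b`. -/
def quadGrad (l : ℝ) (D : H2 →L[ℝ] H2) (b x : H2) : H2 :=
  (l / 4) • ContinuousLinearMap.adjoint D (D x - b)

lemma convexOn_quad {l : ℝ} (hl : 0 ≤ l) (D : H2 →L[ℝ] H2) (b : H2) :
    ConvexOn ℝ Set.univ (quad l D b) := by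
  have h1 : ConvexOn ℝ Set.univ (fun x : H2 => ‖x‖ ^ 2) :=
    (convexOn_norm convex_univ).pow (fun _ _ => norm_nonneg _) 2
  have h2 := h1.comp_affineMap (D.toLinearMap.toAffineMap - AffineMap.const ℝ H2 b)
  exact (h2.smul (by positivity : 0 ≤ l / 8))

lemma hasGradientAt_quad (l : ℝ) (D : H2 →L[ℝ] H2) (b x : H2) :
    HasGradientAt (quad l D b) (quadGrad l D b x) x := by
  rw [hasGradientAt_iff_hasFDerivAt]
  have h := ((D.hasFDerivAt (x := x)).sub_const b).norm_sq.const_mul (l / 8)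
  refine h.congr_fderiv ?_
  ext d
  simp [quadGrad, ContinuousLinearMap.adjoint_inner_left]
  ring

lemma norm_quadGrad_sub_le {l : ℝ} (hl : 0 ≤ l) {D : H2 →L[ℝ] H2} (hD : ‖D‖ ≤ 2) (b x y : H2) :
    ‖quadGrad l D b x - quadGrad l D b y‖ ≤ l * ‖x - y‖ := by
  have h : quadGrad l D b x - quadGrad l D b y
      = (l / 4) • ContinuousLinearMap.adjoint D (D (x - y)) := by
    simp only [quadGrad, ← smul_sub, ← map_sub]
    congr 2
    simp
  rw [h, norm_smul, Real.norm_of_nonneg (by positivity)]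
  have h1 := (ContinuousLinearMap.adjoint D).le_opNorm (D (x - y))
  have h2 := D.le_opNorm (x - y)
  rw [LinearIsometryEquiv.norm_map] at h1
  have h3 : ‖D‖ * ‖D (x - y)‖ ≤ 2 * (2 * ‖x - y‖) := by
    have : ‖D‖ * ‖x - y‖ ≤ 2 * ‖x - y‖ := by gcongr
    gcongr
    linarith
  calc l / 4 * _ ≤ l / 4 * (2 * (2 * ‖x - y‖)) := by gcongr; linarith
    _ = _ := by ring

lemma quad_add (l : ℝ) (D : H2 →L[ℝ] H2) (b x d : H2) :
    quad l D b (x + d) = quad l D b x + ⟪quadGrad l D b x, d⟫_ℝ + l / 8 * ‖D d‖ ^ 2 := by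
  have : D (x + d) - b = (D x - b) + D d := by rw [map_add]; abel
  simp only [quad, quadGrad, this, norm_add_sq_real, inner_smul_left,
    ContinuousLinearMap.adjoint_inner_left, RCLike.conj_to_real]
  ring

lemma isMin_of_stationary {n : ℕ} {μ l : ℝ} (hμ : 0 ≤ μ) (hl : 0 ≤ l)
    (D : Fin n → H2 →L[ℝ] H2) (b : Fin n → H2) (x : H2)
    (hx : μ • x + (1 / (n : ℝ)) • ∑ i, quadGrad l (D i) (b i) x = 0) (y : H2) :
    μ / 2 * ‖x‖ ^ 2 + (1 / (n : ℝ)) * ∑ i, quad l (D i) (b i) x ≤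
      μ / 2 * ‖y‖ ^ 2 + (1 / (n : ℝ)) * ∑ i, quad l (D i) (b i) y := by
  obtain ⟨d, rfl⟩ : ∃ d, y = x + d := ⟨y - x, by abel⟩
  have h := congrArg (fun z => ⟪z, d⟫_ℝ) hx
  simp only [inner_add_left, inner_smul_left, sum_inner, RCLike.conj_to_real,
    inner_zero_left] at h
  have hs : 0 ≤ (1 / (n : ℝ)) * ∑ i, l / 8 * ‖D i d‖ ^ 2 := by positivity
  simp only [quad_add, Finset.sum_add_distrib, norm_add_sq_real, mul_add]
  have : 0 ≤ μ / 2 * ‖d‖ ^ 2 := by positivity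
  linarith

/-- The standard unit vectors of `ℓ2`. -/
def unitVec (j : ℕ) : H2 := lp.single 2 j (1 : ℝ)

lemma inner_unitVec (j : ℕ) (x : H2) : ⟪unitVec j, x⟫_ℝ = x j := by
  simp [unitVec, lp.inner_single_left]

lemma orthonormal_unitVec : Orthonormal ℝ unitVec := by
  rw [orthonormal_iff_ite]
  intro i j
  rw [inner_unitVec, unitVec, lp.single_apply, Pi.single_apply]

/-- The isometry of `ℓ2` sending the unit vectors to a given orthonormal sequence. -/
def embed (v : ℕ → H2) (hv : Orthonormal ℝ v) : H2 →ₗᵢ[ℝ] H2 :=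
  hv.orthogonalFamily.linearIsometry

lemma embed_unitVec (v : ℕ → H2) (hv : Orthonormal ℝ v) (j : ℕ) :
    embed v hv (unitVec j) = v j := by
  simp [embed, unitVec]

lemma embed_apply (v : ℕ → H2) (hv : Orthonormal ℝ v) (x : H2) :
    embed v hv x = ∑' j, x j • v j := by
  rw [embed, OrthogonalFamily.linearIsometry_apply]
  simp

/-- The adjoint of `embed v hv`, which computes the coefficients along `v`. -/
def coeffs (v : ℕ → H2) (hv : Orthonormal ℝ v) : H2 →L[ℝ] H2 :=
  ContinuousLinearMap.adjoint (embed v hv).toContinuousLinearMap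

lemma coeffs_apply (v : ℕ → H2) (hv : Orthonormal ℝ v) (x : H2) (j : ℕ) :
    coeffs v hv x j = ⟪v j, x⟫_ℝ := by
  rw [← inner_unitVec, coeffs, ContinuousLinearMap.adjoint_inner_right,
    LinearIsometry.coe_toContinuousLinearMap, embed_unitVec]

lemma coeffs_embed (v : ℕ → H2) (hv : Orthonormal ℝ v) (x : H2) :
    coeffs v hv (embed v hv x) = x := by
  refine ext_inner_left ℝ fun y => ?_
  rw [coeffs, ContinuousLinearMap.adjoint_inner_right,
    LinearIsometry.coe_toContinuousLinearMap, LinearIsometry.inner_map_map]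

lemma adjoint_coeffs (v : ℕ → H2) (hv : Orthonormal ℝ v) (x : H2) :
    ContinuousLinearMap.adjoint (coeffs v hv) x = embed v hv x := by
  rw [coeffs, ContinuousLinearMap.adjoint_adjoint, LinearIsometry.coe_toContinuousLinearMap]

lemma norm_coeffs_le (v : ℕ → H2) (hv : Orthonormal ℝ v) : ‖coeffs v hv‖ ≤ 1 := by
  rw [coeffs, LinearIsometryEquiv.norm_map]
  exact LinearIsometry.norm_toContinuousLinearMap_le _

lemma orthonormal_unitVec_succ : Orthonormal ℝ (fun j => unitVec (j + 1)) :=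
  orthonormal_unitVec.comp _ (add_left_injective 1)

/-- The right shift of `ℓ2`. -/
def shift : H2 →L[ℝ] H2 := (embed _ orthonormal_unitVec_succ).toContinuousLinearMap

/-- The left shift of `ℓ2`. -/
def leftShift : H2 →L[ℝ] H2 := coeffs _ orthonormal_unitVec_succ

lemma adjoint_shift : ContinuousLinearMap.adjoint shift = leftShift := rfl

lemma leftShift_apply (x : H2) (j : ℕ) : leftShift x j = x (j + 1) := by
  rw [leftShift, coeffs_apply, inner_unitVec]

lemma leftShift_shift (x : H2) : leftShift (shift x) = x := coeffs_embed _ _ x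

lemma leftShift_unitVec_zero : leftShift (unitVec 0) = 0 := by
  ext j
  rw [leftShift_apply, unitVec, lp.single_apply]
  simp

lemma shift_apply_succ (x : H2) (j : ℕ) : shift x (j + 1) = x j := by
  rw [← leftShift_apply, leftShift_shift]

/-- The backward difference operator of `ℓ2`. -/
def diff : H2 →L[ℝ] H2 := ContinuousLinearMap.id ℝ H2 - shift

lemma diff_apply (x : H2) : diff x = x - shift x := rfl

lemma adjoint_diff_apply (x : H2) :
    ContinuousLinearMap.adjoint diff x = x - leftShift x := by
  rw [diff, map_sub, adjoint_shift, ContinuousLinearMap.adjoint_id]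
  rfl

lemma norm_diff_le : ‖diff‖ ≤ 2 := by
  refine (norm_sub_le _ _).trans ?_
  have h1 := ContinuousLinearMap.norm_id_le (𝕜 := ℝ) (E := H2)
  have h2 : ‖shift‖ ≤ 1 := LinearIsometry.norm_toContinuousLinearMap_le _
  linarith

/-- The difference operator acting on the coefficients along `v`. -/
def chain (v : ℕ → H2) (hv : Orthonormal ℝ v) : H2 →L[ℝ] H2 := diff ∘L coeffs v hv

lemma norm_chain_le (v : ℕ → H2) (hv : Orthonormal ℝ v) : ‖chain v hv‖ ≤ 2 := by
  refine (ContinuousLinearMap.opNorm_comp_le _ _).trans ?_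
  calc _ ≤ (2 : ℝ) * 1 := mul_le_mul norm_diff_le (norm_coeffs_le v hv) (norm_nonneg _) (by simp)
    _ = 2 := by norm_num

lemma quadGrad_chain (l : ℝ) (v : ℕ → H2) (hv : Orthonormal ℝ v) (b x : H2) :
    quadGrad l (chain v hv) b x
      = embed v hv (quadGrad l diff b (coeffs v hv x)) := by
  simp only [quadGrad, chain, ContinuousLinearMap.adjoint_comp, ContinuousLinearMap.comp_apply,
    adjoint_coeffs, map_smul]

lemma quadGrad_diff_apply_eq_zero (l : ℝ) {y : H2} {t : ℕ} (hy : ∀ j, t ≤ j → y j = 0) {j : ℕ}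
    (hj : t < j) : quadGrad l diff (unitVec 0) y j = 0 := by
  have key : ∀ m, t < m → (diff y - unitVec 0) m = 0 := by
    intro m hm
    obtain ⟨m, rfl⟩ : ∃ r, m = r + 1 := ⟨m - 1, by omega⟩
    have : (unitVec 0) (m + 1) = 0 := by rw [unitVec, lp.single_apply]; simp
    rw [lp.coeFn_sub, Pi.sub_apply, this, diff_apply, lp.coeFn_sub, Pi.sub_apply,
      shift_apply_succ, hy _ hm.le, hy m (by omega)]
    simp
  rw [quadGrad, adjoint_diff_apply, lp.coeFn_smul, Pi.smul_apply, lp.coeFn_sub, Pi.sub_apply,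
    leftShift_apply, key j hj, key (j + 1) (by omega)]
  simp

section Locality

variable {v w : ℕ → H2} (hv : Orthonormal ℝ v) (hw : Orthonormal ℝ w) {t : ℕ} {x : H2}

lemma coeffs_congr (h : ∀ j < t, v j = w j) (hvx : ∀ j, t ≤ j → ⟪v j, x⟫_ℝ = 0)
    (hwx : ∀ j, t ≤ j → ⟪w j, x⟫_ℝ = 0) : coeffs v hv x = coeffs w hw x := by
  ext j
  rw [coeffs_apply, coeffs_apply]
  rcases lt_or_ge j t with hj | hj
  · rw [h j hj]
  · rw [hvx j hj, hwx j hj]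

lemma quad_chain_congr (l : ℝ) (b : H2) (h : ∀ j < t, v j = w j)
    (hvx : ∀ j, t ≤ j → ⟪v j, x⟫_ℝ = 0) (hwx : ∀ j, t ≤ j → ⟪w j, x⟫_ℝ = 0) :
    quad l (chain v hv) b x = quad l (chain w hw) b x := by
  simp only [quad, chain, ContinuousLinearMap.comp_apply, coeffs_congr hv hw h hvx hwx]

lemma quadGrad_chain_congr (l : ℝ) (h : ∀ j ≤ t, v j = w j)
    (hvx : ∀ j, t ≤ j → ⟪v j, x⟫_ℝ = 0) (hwx : ∀ j, t ≤ j → ⟪w j, x⟫_ℝ = 0) :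
    quadGrad l (chain v hv) (unitVec 0) x = quadGrad l (chain w hw) (unitVec 0) x := by
  rw [quadGrad_chain, quadGrad_chain, coeffs_congr hv hw (fun j hj => h j hj.le) hvx hwx,
    embed_apply, embed_apply]
  refine tsum_congr fun j => ?_
  rcases le_or_gt j t with hj | hj
  · rw [h j hj]
  · rw [quadGrad_diff_apply_eq_zero l (fun m hm => by rw [coeffs_apply, hwx m hm]) hj]
    simp

end Locality

lemma exists_orthonormal_orthogonal (S : Finset H2) :
    ∃ e : ℕ → H2, Orthonormal ℝ e ∧ ∀ j, ∀ x ∈ S, ⟪e j, x⟫_ℝ = 0 := by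
  let W : Submodule ℝ H2 := Submodule.span ℝ (S : Set H2)
  obtain ⟨s, b, hb⟩ := exists_hilbertBasis ℝ Wᗮ
  have hs : Infinite s := by
    by_contra hfin
    rw [not_infinite_iff_finite] at hfin
    have := Fintype.ofFinite s
    have hW : FiniteDimensional ℝ Wᗮ := b.toOrthonormalBasis.toBasis.finiteDimensional_of_finite
    have hsup : FiniteDimensional ℝ (W ⊔ Wᗮ : Submodule ℝ H2) := inferInstance
    rw [Submodule.sup_orthogonal_of_hasOrthogonalProjection] at hsup
    have hH : FiniteDimensional ℝ H2 := Submodule.topEquiv.finiteDimensional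
    exact not_finite_iff_infinite.mpr inferInstance
      (orthonormal_unitVec.linearIndependent.finite)
  refine ⟨fun j => (b (Infinite.natEmbedding s j) : H2), ?_, fun j x hx => ?_⟩
  · exact (b.orthonormal.comp _ (Infinite.natEmbedding s).injective).comp_linearIsometry
      (Wᗮ).subtypeₗᵢ
  · exact (Submodule.mem_orthogonal' W _).mp (b _).2 x (Submodule.subset_span hx)

lemma exists_orthonormal_extension {n : ℕ} {v : Fin n × ℕ → H2} (hv : Orthonormal ℝ v)
    (t : Fin n → ℕ) (S : Finset H2) :
    ∃ w : Fin n × ℕ → H2, Orthonormal ℝ w ∧ (∀ i, ∀ j < t i, w (i, j) = v (i, j)) ∧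
      ∀ i j, t i ≤ j → ∀ x ∈ S, ⟪w (i, j), x⟫_ℝ = 0 := by
  classical
  let T : Finset H2 := Finset.univ.biUnion fun i => (Finset.range (t i)).image fun j => v (i, j)
  obtain ⟨e, he, heS⟩ := exists_orthonormal_orthogonal (S ∪ T)
  have heT : ∀ m, ∀ p : Fin n × ℕ, p.2 < t p.1 → ⟪e m, v p⟫_ℝ = 0 := by
    intro m p hp
    refine heS m _ (Finset.mem_union_right _ ?_)
    simp only [T, Finset.mem_biUnion, Finset.mem_univ, true_and, Finset.mem_image,
      Finset.mem_range]
    exact ⟨p.1, p.2, hp, rfl⟩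
  refine ⟨fun p => if p.2 < t p.1 then v p else e (Encodable.encode p), ?_, ?_, ?_⟩
  · rw [orthonormal_iff_ite] at hv he ⊢
    intro p r
    by_cases hp : p.2 < t p.1 <;> by_cases hr : r.2 < t r.1
    · simpa only [hp, hr, if_true] using hv p r
    · have : p ≠ r := by rintro rfl; exact hr hp
      simp only [hp, hr, if_true, if_false, this]
      rw [real_inner_comm]
      exact heT _ _ hp
    · have : p ≠ r := by rintro rfl; exact hp hr
      simp only [hp, hr, if_true, if_false, this]
      exact heT _ _ hr
    · simp only [hp, hr, if_false, he, Encodable.encode_inj]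
  · intro i j hj
    simp [hj]
  · intro i j hj x hx
    simp only [not_lt.mpr hj, if_false]
    exact heS _ _ (Finset.mem_union_left _ hx)

lemma Orthonormal.row {n : ℕ} {v : Fin n × ℕ → H2} (hv : Orthonormal ℝ v) (i : Fin n) :
    Orthonormal ℝ fun j => v (i, j) :=
  hv.comp _ (Prod.mk_right_injective i)

lemma inner_embed_left (v : ℕ → H2) (hv : Orthonormal ℝ v) (x y : H2) :
    ⟪embed v hv x, y⟫_ℝ = ⟪x, coeffs v hv y⟫_ℝ := by
  rw [coeffs, ContinuousLinearMap.adjoint_inner_right, LinearIsometry.coe_toContinuousLinearMap]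

lemma coeffs_row_embed_row {n : ℕ} {v : Fin n × ℕ → H2} (hv : Orthonormal ℝ v) {i k : Fin n}
    (hik : i ≠ k) (x : H2) : coeffs _ (hv.row i) (embed _ (hv.row k) x) = 0 := by
  ext j
  rw [coeffs_apply, real_inner_comm, inner_embed_left]
  have : coeffs _ (hv.row k) (v (i, j)) = 0 := by
    ext m
    rw [coeffs_apply, orthonormal_iff_ite.mp hv, if_neg (by simp [hik.symm])]
    rfl
  rw [this, inner_zero_right]
  rfl

lemma coeffs_row_sum_embed {n : ℕ} {v : Fin n × ℕ → H2} (hv : Orthonormal ℝ v) (i : Fin n)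
    (x : Fin n → H2) : coeffs _ (hv.row i) (∑ k, embed _ (hv.row k) (x k)) = x i := by
  rw [map_sum, Finset.sum_eq_single i, coeffs_embed]
  · exact fun k _ hk => coeffs_row_embed_row hv hk.symm _
  · simp

lemma inner_sum_embed {n : ℕ} {v : Fin n × ℕ → H2} (hv : Orthonormal ℝ v) (x : Fin n → H2)
    (y : H2) : ⟪∑ k, embed _ (hv.row k) (x k), y⟫_ℝ = ∑ k, ⟪x k, coeffs _ (hv.row k) y⟫_ℝ := by
  simp only [sum_inner, inner_embed_left]

lemma exists_geometric {q : ℝ} (hq0 : 0 < q) (hq1 : q < 1) :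
    ∃ z : H2, z ≠ 0 ∧ leftShift z = q • z ∧ z = q • (unitVec 0 + shift z) := by
  have hmem : Memℓp (fun j : ℕ => q ^ (j + 1)) 2 := by
    refine memℓp_gen ?_
    have : Summable fun j : ℕ => q ^ 2 * (q ^ 2) ^ j :=
      (summable_geometric_of_lt_one (by positivity) (by nlinarith)).mul_left _
    refine this.congr fun j => ?_
    rw [Real.norm_of_nonneg (by positivity)]
    norm_num
    ring
  let z : H2 := ⟨fun j => q ^ (j + 1), hmem⟩
  have hz : ∀ j, z j = q ^ (j + 1) := fun _ => rfl
  refine ⟨z, fun h => ?_, ?_, ?_⟩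
  · have := hz 0
    rw [h] at this
    simp at this
    exact hq0.ne this
  · ext j
    rw [leftShift_apply, lp.coeFn_smul, Pi.smul_apply, hz, hz, smul_eq_mul]
    ring
  · ext j
    rw [lp.coeFn_smul, Pi.smul_apply, lp.coeFn_add, Pi.add_apply, hz, smul_eq_mul]
    cases j with
    | zero =>
      rw [← inner_unitVec 0 (shift z), ← ContinuousLinearMap.adjoint_inner_left, adjoint_shift,
        leftShift_unitVec_zero, inner_zero_left, unitVec, lp.single_apply_self]
      ring
    | succ j =>
      rw [shift_apply_succ, hz, unitVec, lp.single_apply]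
      simp
      ring

lemma quadGrad_diff_geometric (l : ℝ) {q : ℝ} (hq : q ≠ 0) {z : H2}
    (hz : leftShift z = q • z) (hz' : z = q • (unitVec 0 + shift z)) :
    quadGrad l diff (unitVec 0) z = -(l / 4 * ((1 - q) ^ 2 / q)) • z := by
  have h1 : diff z - unitVec 0 = (1 - 1 / q) • z := by
    have : unitVec 0 + shift z = q⁻¹ • z := by
      conv_rhs => rw [hz']
      rw [smul_smul, inv_mul_cancel₀ hq, one_smul]
    rw [diff_apply, sub_smul, one_smul, one_div, ← this]
    abel
  rw [quadGrad, h1, map_smul, adjoint_diff_apply, hz]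
  match_scalars
  field_simp
  ring

lemma leftShift_pow_apply (x : H2) (t j : ℕ) : (leftShift ^ t) x j = x (j + t) := by
  induction t generalizing x with
  | zero => simp
  | succ t ih =>
    rw [pow_succ, mul_apply_eq_comp, ih, leftShift_apply]
    congr 1

/-- If `p` has no component along the rows of `v` beyond `t`, then it is at distance at least
`(∑ i, q ^ (2 t i)) ^ (1/2) ‖z‖` from the vector all of whose rows are the geometric vector `z`. -/
lemma sum_pow_mul_norm_sq_le {n : ℕ} {v : Fin n × ℕ → H2} (hv : Orthonormal ℝ v) {q : ℝ}
    {z : H2} (hz : leftShift z = q • z) (t : Fin n → ℕ) {p : H2}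
    (hp : ∀ i j, t i ≤ j → ⟪v (i, j), p⟫_ℝ = 0) :
    (∑ i, q ^ (2 * t i)) * ‖z‖ ^ 2 ≤ ‖∑ i, embed _ (hv.row i) z - p‖ ^ 2 := by
  have hadj : ∀ (m : ℕ) (x y : H2), ⟪(shift ^ m) x, y⟫_ℝ = ⟪x, (leftShift ^ m) y⟫_ℝ := by
    intro m
    induction m with
    | zero => simp
    | succ m ih =>
      intro x y
      rw [pow_succ, pow_succ', mul_apply_eq_comp, mul_apply_eq_comp, ih,
        ← adjoint_shift, ContinuousLinearMap.adjoint_inner_right]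
  have hpow : ∀ m : ℕ, (leftShift ^ m) z = q ^ m • z := by
    intro m
    induction m with
    | zero => simp
    | succ m ih => rw [pow_succ, mul_apply_eq_comp, hz, map_smul, ih, smul_smul,
        pow_succ']
  have hinv : ∀ (m : ℕ) (x : H2), (leftShift ^ m) ((shift ^ m) x) = x := by
    intro m
    induction m with
    | zero => simp
    | succ m ih =>
      intro x
      rw [pow_succ, pow_succ' shift, mul_apply_eq_comp,
        mul_apply_eq_comp, leftShift_shift, ih]
  set r : H2 := ∑ i, embed _ (hv.row i) (q ^ t i • (shift ^ t i) z) with hr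
  have hrr : ⟪r, r⟫_ℝ = (∑ i, q ^ (2 * t i)) * ‖z‖ ^ 2 := by
    conv_lhs => rw [hr, inner_sum_embed hv]
    rw [Finset.sum_mul]
    refine Finset.sum_congr rfl fun i _ => ?_
    rw [coeffs_row_sum_embed hv, inner_smul_left, inner_smul_right, hadj, hinv,
      real_inner_self_eq_norm_sq, RCLike.conj_to_real]
    ring
  have hrx : ⟪r, ∑ i, embed _ (hv.row i) z⟫_ℝ = (∑ i, q ^ (2 * t i)) * ‖z‖ ^ 2 := by
    rw [hr, inner_sum_embed hv, Finset.sum_mul]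
    refine Finset.sum_congr rfl fun i _ => ?_
    rw [coeffs_row_sum_embed hv i fun _ => z, inner_smul_left, hadj, hpow, inner_smul_right,
      real_inner_self_eq_norm_sq, RCLike.conj_to_real]
    ring
  have hrp : ⟪r, p⟫_ℝ = 0 := by
    rw [hr, inner_sum_embed hv]
    refine Finset.sum_eq_zero fun i _ => ?_
    have : (leftShift ^ t i) (coeffs _ (hv.row i) p) = 0 := by
      ext j
      rw [leftShift_pow_apply, coeffs_apply, hp i _ (Nat.le_add_left _ _)]
      rfl
    rw [inner_smul_left, hadj, this, inner_zero_right, mul_zero]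
  have hcs := real_inner_le_norm r (∑ i, embed _ (hv.row i) z - p)
  rw [inner_sub_right, hrx, hrp, sub_zero, ← hrr, real_inner_self_eq_norm_sq] at hcs
  rw [← hrr, real_inner_self_eq_norm_sq]
  rcases (norm_nonneg r).eq_or_lt with h0 | h0
  · rw [← h0, zero_pow two_ne_zero]
    exact sq_nonneg _
  · have : ‖r‖ ≤ ‖∑ i, embed _ (hv.row i) z - p‖ := by
      rw [sq] at hcs
      exact le_of_mul_le_mul_left hcs h0
    gcongr

lemma norm_sq_sum_embed {n : ℕ} {v : Fin n × ℕ → H2} (hv : Orthonormal ℝ v) (z : H2) :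
    ‖∑ i, embed _ (hv.row i) z‖ ^ 2 = n * ‖z‖ ^ 2 := by
  rw [← real_inner_self_eq_norm_sq, inner_sum_embed hv fun _ => z]
  simp only [coeffs_row_sum_embed hv _ fun _ => z, real_inner_self_eq_norm_sq]
  simp

lemma stationary_sum_embed {n : ℕ} (hn : 1 ≤ n) {v : Fin n × ℕ → H2} (hv : Orthonormal ℝ v)
    {μ l q : ℝ} (hq : q ≠ 0) (hq' : l * ((1 - q) ^ 2 / q) = 4 * n * μ) {z : H2}
    (hz : leftShift z = q • z) (hz' : z = q • (unitVec 0 + shift z)) :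
    μ • (∑ i, embed _ (hv.row i) z) + (1 / (n : ℝ)) •
      ∑ i, quadGrad l (chain _ (hv.row i)) (unitVec 0) (∑ k, embed _ (hv.row k) z) = 0 := by
  have hn0 : (n : ℝ) ≠ 0 := by positivity
  simp only [quadGrad_chain, coeffs_row_sum_embed hv _ fun _ => z,
    quadGrad_diff_geometric l hq hz hz', map_smul, ← Finset.smul_sum, smul_smul, ← add_smul]
  convert zero_smul ℝ _
  rw [show l / 4 * ((1 - q) ^ 2 / q) = n * μ by linarith]
  field_simp
  ring

namespace IFOAlgorithm

variable {n K : ℕ} (A : IFOAlgorithm n K)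

lemma answers_congr_of_forall_ne {g g' : Fin n → H2 → ℝ} {gg gg' : Fin n → H2 → H2} {i : Fin n}
    (hg : ∀ j ≠ i, g j = g' j) (hgg : ∀ j ≠ i, gg j = gg' j) (k : ℕ)
    (hi : ∀ m < k, (A.query m (A.answers g gg m)).1 ≠ i) :
    A.answers g' gg' k = A.answers g gg k := by
  induction k with
  | zero => rfl
  | succ k ih =>
    have h := hi k k.lt_succ_self
    simp only [answers, ih fun m hm => hi m (hm.trans k.lt_succ_self), hg _ h, hgg _ h]

/-- The resisting oracle: the chains can be chosen so that every oracle call reveals at most one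
further vector of one of the chains. -/
lemma exists_resisting_chain (l : ℝ) (k : ℕ) :
    ∃ (t : Fin n → ℕ) (v : Fin n × ℕ → H2) (S : Finset H2) (h : Fin k → ℝ × H2),
      ∑ i, t i = k ∧ Orthonormal ℝ v ∧
      ∀ (w : Fin n × ℕ → H2) (hw : Orthonormal ℝ w), (∀ i, ∀ j < t i, w (i, j) = v (i, j)) →
        (∀ i j, t i ≤ j → ∀ x ∈ S, ⟪w (i, j), x⟫_ℝ = 0) →
        A.answers (fun i => quad l (chain _ (hw.row i)) (unitVec 0))
          (fun i => quadGrad l (chain _ (hw.row i)) (unitVec 0)) k = h := by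
  classical
  induction k with
  | zero =>
    refine ⟨0, fun p => unitVec (Encodable.encode p), ∅, Fin.elim0, by simp,
      orthonormal_unitVec.comp _ Encodable.encode_injective, fun w hw _ _ => rfl⟩
  | succ k ih =>
    obtain ⟨t, v, S, h, ht, hv, H⟩ := ih
    obtain ⟨⟨i, x⟩, hQ⟩ : ∃ p, A.query k h = p := ⟨_, rfl⟩
    obtain ⟨u, hu, huv, huS⟩ := exists_orthonormal_extension hv t (insert x S)
    have htle : ∀ j, t j ≤ (t + Pi.single i 1 : Fin n → ℕ) j := fun j => by simp
    refine ⟨t + Pi.single i 1, u, insert x S,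
      Fin.snoc h (quad l (chain _ (hu.row i)) (unitVec 0) x,
        quadGrad l (chain _ (hu.row i)) (unitVec 0) x), ?_, hu, fun w hw hwu hwS => ?_⟩
    · simp [Finset.sum_add_distrib, ht]
    · have hwS' : ∀ m j, t m ≤ j → ∀ y ∈ insert x S, ⟪w (m, j), y⟫_ℝ = 0 := by
        intro m j hj y hy
        rcases lt_or_ge j ((t + Pi.single i 1 : Fin n → ℕ) m) with hlt | hge
        · rw [hwu m j hlt]
          exact huS m j hj y hy
        · exact hwS m j hge y hy
      have hans := H w hw
        (fun m j hj => (hwu m j (hj.trans_le (htle m))).trans (huv m j hj))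
        (fun m j hj y hy => hwS' m j hj y (Finset.mem_insert_of_mem hy))
      have hle : ∀ j ≤ t i, w (i, j) = u (i, j) := fun j hj =>
        hwu i j (by simp; omega)
      have hwx := fun j hj => hwS' i j hj x (Finset.mem_insert_self _ _)
      have hux := fun j hj => huS i j hj x (Finset.mem_insert_self _ _)
      simp only [answers, hans, hQ]
      rw [quad_chain_congr (hw.row i) (hu.row i) l _ (fun j hj => hle j hj.le) hwx hux,
        quadGrad_chain_congr (hw.row i) (hu.row i) l hle hwx hux]

end IFOAlgorithm

lemma mul_exp_le_sum_exp {n : ℕ} (hn : 1 ≤ n) (t : Fin n → ℕ) (K : ℕ) (ht : ∑ i, t i = K)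
    (a : ℝ) : n * Real.exp (-(a * K / n)) ≤ ∑ i, Real.exp (-a) ^ t i := by
  have hn0 : (n : ℝ) ≠ 0 := by positivity
  have htR : ∑ i, (t i : ℝ) = K := by exact_mod_cast ht
  calc (n : ℝ) * Real.exp (-(a * K / n))
      = ∑ i, Real.exp (-(a * K / n)) * (a * K / n - a * t i + 1) := by
        rw [← Finset.mul_sum, Finset.sum_add_distrib, Finset.sum_sub_distrib, ← Finset.mul_sum,
          htR]
        simp
        field_simp
        ring
    _ ≤ ∑ i, Real.exp (-a) ^ t i := by
        refine Finset.sum_le_sum fun i _ => ?_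
        calc _ ≤ Real.exp (-(a * K / n)) * Real.exp (a * K / n - a * t i) := by
              gcongr
              exact Real.add_one_le_exp _
          _ = _ := by
              rw [← Real.exp_add, ← Real.exp_nat_mul]
              congr 1
              ring

lemma exists_decay_rate {s : ℝ} (hs : 0 < s) :
    ∃ a : ℝ, 0 < a ∧ a * s ≤ 2 ∧ (1 - Real.exp (-a)) ^ 2 / Real.exp (-a) = 4 / s ^ 2 := by
  have h0 : 0 < Real.arsinh (1 / s) := Real.arsinh_pos_iff.mpr (by positivity)
  refine ⟨2 * Real.arsinh (1 / s), by positivity, ?_, ?_⟩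
  · have : Real.arsinh (1 / s) ≤ 1 / s := by
      conv_rhs => rw [← Real.sinh_arsinh (1 / s)]
      exact Real.self_le_sinh_iff.mpr h0.le
    calc _ ≤ 2 * (1 / s) * s := by gcongr
      _ = 2 := by field_simp
  · have h := Real.sinh_arsinh (1 / s)
    set b := Real.arsinh (1 / s)
    rw [Real.sinh_eq, Real.exp_neg] at h
    have hE : Real.exp (-(2 * b)) = (Real.exp b)⁻¹ ^ 2 := by
      rw [← Real.exp_neg, ← Real.exp_nat_mul]
      congr 1
      push_cast
      ring
    rw [hE]
    have hb := Real.exp_pos b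
    have h4 : 4 / s ^ 2 = 4 * (1 / s) ^ 2 := by ring
    rw [h4, ← h]
    field_simp
    ring

/-- If a deterministic IFO algorithm making `K` calls guarantees
`‖x*_f − x_K‖ ≤ ε‖x*_f‖` for every `f ∈ F^{μ,L}_n(ℓ2)` (given by convex `(L−μ)`-smooth
components `g i` with gradients `gg i` and minimizer `xstar`), then `K ≥ n` and
`K ≥ (1/4)·√(n(κ−1))·log(1/ε)`. -/
theorem ifo_iteration_lower_bound (μ L : ℝ) (hμ : 0 < μ) (hμL : μ < L) (n K : ℕ)
    (hn : 1 ≤ n) (κ : ℝ) (hκ : κ = L / μ) (ε : ℝ) (hε0 : 0 < ε) (hε1 : ε < 1)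
    (A : IFOAlgorithm n K)
    (hguarantee : ∀ (g : Fin n → H2 → ℝ) (gg : Fin n → H2 → H2) (xstar : H2),
      (∀ i, ConvexOn ℝ Set.univ (g i)) →
      (∀ i x, HasGradientAt (g i) (gg i x) x) →
      (∀ i x y, ‖gg i x - gg i y‖ ≤ (L - μ) * ‖x - y‖) →
      (∀ y : H2,
        μ / 2 * ‖xstar‖ ^ 2 + (1 / (n : ℝ)) * ∑ i, g i xstar ≤
          μ / 2 * ‖y‖ ^ 2 + (1 / (n : ℝ)) * ∑ i, g i y) →
      ‖xstar - A.run g gg‖ ≤ ε * ‖xstar‖) :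
    n ≤ K ∧ (1 / 4) * Real.sqrt (n * (κ - 1)) * Real.log (1 / ε) ≤ (K : ℝ) := by
  have hl : 0 < L - μ := sub_pos.mpr hμL
  have hnR : (0 : ℝ) < n := by positivity
  refine ⟨?_, ?_⟩
  · by_contra! hKn
    obtain ⟨i, hi⟩ : ∃ i : Fin n, ∀ m < K, (A.query m (A.answers 0 0 m)).1 ≠ i := by
      by_contra! hall
      choose m hm hmi using hall
      have := Fintype.card_le_of_injective (fun i : Fin n => (⟨m i, hm i⟩ : Fin K)) (by
        intro i j hij
        have hmij : m i = m j := congrArg Fin.val hij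
        rw [← hmi i, ← hmi j, hmij])
      simp at this
      omega
    obtain ⟨e, he, hep⟩ := exists_orthonormal_orthogonal {A.run 0 0}
    have hep := hep 0 _ (Finset.mem_singleton_self _)
    have he1 : ‖e 0‖ = 1 := he.1 0
    let D : Fin n → H2 →L[ℝ] H2 := Pi.single i (ContinuousLinearMap.id ℝ H2)
    let b : Fin n → H2 := Pi.single i ((1 + 4 * n * μ / (L - μ)) • e 0)
    have hDi : D i = ContinuousLinearMap.id ℝ H2 := Pi.single_eq_same _ _
    have hbi : b i = (1 + 4 * n * μ / (L - μ)) • e 0 := Pi.single_eq_same _ _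
    have hDj : ∀ j ≠ i, D j = 0 := fun j hj => Pi.single_eq_of_ne hj _
    have hbj : ∀ j ≠ i, b j = 0 := fun j hj => Pi.single_eq_of_ne hj _
    have hD : ∀ j, ‖D j‖ ≤ 2 := by
      intro j
      rcases eq_or_ne j i with rfl | hj
      · rw [hDi]
        exact ContinuousLinearMap.norm_id_le.trans one_le_two
      · simp [hDj j hj]
    have hrun : A.run (fun j => quad (L - μ) (D j) (b j))
        (fun j => quadGrad (L - μ) (D j) (b j)) = A.run 0 0 := by
      refine congrArg A.output (A.answers_congr_of_forall_ne (i := i) ?_ ?_ K hi)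
      · intro j hj
        ext x
        simp [quad, hDj j hj, hbj j hj]
      · intro j hj
        ext1 x
        simp [quadGrad, hDj j hj, hbj j hj]
    have h := hguarantee _ _ (e 0) (fun j => convexOn_quad hl.le (D j) (b j))
      (fun j => hasGradientAt_quad (L - μ) (D j) (b j))
      (fun j => norm_quadGrad_sub_le hl.le (hD j) (b j))
      (isMin_of_stationary hμ.le hl.le D b _ (by
        rw [Finset.sum_eq_single i]
        · rw [quadGrad, hDi, hbi, ContinuousLinearMap.adjoint_id]
          simp only [ContinuousLinearMap.id_apply]
          match_scalars
          field_simp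
          ring
        · intro j _ hj
          simp [quadGrad, hDj j hj]
        · simp))
    rw [hrun, he1, mul_one] at h
    have h1 : ⟪e 0, e 0 - A.run 0 0⟫_ℝ = 1 := by
      rw [inner_sub_right, hep, real_inner_self_eq_norm_sq, he1]
      norm_num
    have h2 := real_inner_le_norm (e 0) (e 0 - A.run 0 0)
    rw [h1, he1, one_mul] at h2
    linarith
  · have hκ1 : 0 < κ - 1 := by
      rw [hκ, sub_pos, one_lt_div hμ]
      exact hμL
    have hs : 0 < Real.sqrt ((κ - 1) / n) := Real.sqrt_pos.mpr (by positivity)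
    obtain ⟨a, ha, has, hrate⟩ := exists_decay_rate hs
    rw [Real.sq_sqrt (by positivity)] at hrate
    set q := Real.exp (-a) with hq
    have hq0 : 0 < q := Real.exp_pos _
    have hq1 : q < 1 := Real.exp_lt_one_iff.mpr (by linarith)
    obtain ⟨z, hz0, hz, hz'⟩ := exists_geometric hq0 hq1
    obtain ⟨t, v, S, h, ht, hv, H⟩ := A.exists_resisting_chain (L - μ) K
    classical
    obtain ⟨w, hw, hwv, hwS⟩ := exists_orthonormal_extension hv t (insert (A.output h) S)
    have hans := H w hw hwv fun i j hj x hx => hwS i j hj x (Finset.mem_insert_of_mem hx)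
    have hrun : A.run (fun i => quad (L - μ) (chain _ (hw.row i)) (unitVec 0))
        (fun i => quadGrad (L - μ) (chain _ (hw.row i)) (unitVec 0)) = A.output h :=
      congrArg A.output hans
    have hstat : (L - μ) * ((1 - q) ^ 2 / q) = 4 * n * μ := by
      have : κ - 1 = (L - μ) / μ := by rw [hκ]; field_simp
      rw [hrate, this]
      field_simp
    have hmain := hguarantee _ _ (∑ i, embed _ (hw.row i) z)
      (fun i => convexOn_quad hl.le (chain _ (hw.row i)) (unitVec 0))
      (fun i => hasGradientAt_quad (L - μ) (chain _ (hw.row i)) (unitVec 0))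
      (fun i => norm_quadGrad_sub_le hl.le (norm_chain_le _ (hw.row i)) (unitVec 0))
      (isMin_of_stationary hμ.le hl.le _ _ _
        (stationary_sum_embed hn hw hq0.ne' hstat hz hz'))
    rw [hrun] at hmain
    have hlow := sum_pow_mul_norm_sq_le hw hz t (p := A.output h)
      fun i j hj => hwS i j hj _ (Finset.mem_insert_self _ _)
    have hsq := pow_le_pow_left₀ (norm_nonneg _) hmain 2
    rw [mul_pow, norm_sq_sum_embed hw z] at hsq
    have hz2 : 0 < ‖z‖ ^ 2 := by positivity
    have hsum : ∑ i, q ^ (2 * t i) ≤ ε ^ 2 * n := by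
      refine le_of_mul_le_mul_right ?_ hz2
      linarith
    have hexp := mul_exp_le_sum_exp hn t K ht (2 * a)
    have hqe : ∀ i, Real.exp (-(2 * a)) ^ t i = q ^ (2 * t i) := by
      intro i
      rw [pow_mul, hq, ← Real.exp_nat_mul (-a) 2]
      congr 2
      push_cast
      ring
    simp only [hqe] at hexp
    have hε : Real.exp (-(2 * a * K / n)) ≤ ε ^ 2 := by
      refine le_of_mul_le_mul_left ?_ hnR
      linarith
    have hlog : -(2 * a * K / n) ≤ 2 * Real.log ε := by
      have := (Real.le_log_iff_exp_le (by positivity)).mpr hε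
      rwa [Real.log_pow] at this
    have hlog' : n * Real.log (1 / ε) ≤ a * K := by
      rw [one_div, Real.log_inv]
      have : n * -(2 * a * K / n) ≤ n * (2 * Real.log ε) := by gcongr
      have h2 : n * -(2 * a * K / n) = -(2 * a * K) := by field_simp
      linarith
    have hsqrt : Real.sqrt (n * (κ - 1)) = n * Real.sqrt ((κ - 1) / n) := by
      have : n * (κ - 1) = (n : ℝ) ^ 2 * ((κ - 1) / n) := by field_simp
      rw [this, Real.sqrt_mul (by positivity), Real.sqrt_sq hnR.le]
    rw [hsqrt]
    calc 1 / 4 * (n * Real.sqrt ((κ - 1) / n)) * Real.log (1 / ε)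
        = 1 / 4 * Real.sqrt ((κ - 1) / n) * (n * Real.log (1 / ε)) := by ring
      _ ≤ 1 / 4 * Real.sqrt ((κ - 1) / n) * (a * K) := by gcongr
      _ = 1 / 4 * (a * Real.sqrt ((κ - 1) / n)) * K := by ring
      _ ≤ 1 / 4 * 2 * K := by gcongr
      _ ≤ K := by
        have : (0 : ℝ) ≤ K := by positivity
        linarith
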